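/- Let F and g be real polynomials, k a natural number, ε₀ > 0, and D ⊂ ℝ² a compact set such that for every ε with 0 < ε ≤ ε₀ the planar system ẋ = y − εF(x), ẏ = −g(x) has at least k pairwise distinct limit cycles all contained in D. Then there exists x* > 0 such that for every x₀ < −x* and every ε with 0 < ε ≤ ε₀, the planar system ẋ = y − εF(x² + x₀), ẏ = −2x·g(x² + x₀) has at least 2k pairwise distinct limit cycles. -/

import Mathlib

open Filter Polynomial

/-- `Γ` is a periodic orbit of the planar vector field `V`: the image of a
nonconstant periodic solution of `γ' = V ∘ γ`. -/
def IsPeriodicOrbit (V : ℝ × ℝ → ℝ × ℝ) (Γ : Set (ℝ × ℝ)) : Prop :=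
  ∃ γ : ℝ → ℝ × ℝ,
    (∀ t : ℝ, HasDerivAt γ (V (γ t)) t) ∧
    (∃ T : ℝ, 0 < T ∧ Function.Periodic γ T) ∧
    (∃ t₁ t₂ : ℝ, γ t₁ ≠ γ t₂) ∧
    Γ = Set.range γ

/-- `Γ` is a limit cycle of `V`: a periodic orbit which is isolated among
periodic orbits. -/
def IsLimitCycle (V : ℝ × ℝ → ℝ × ℝ) (Γ : Set (ℝ × ℝ)) : Prop :=
  IsPeriodicOrbit V Γ ∧
  ∃ U : Set (ℝ × ℝ), IsOpen U ∧ Γ ⊆ U ∧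
    ∀ Γ' : Set (ℝ × ℝ), IsPeriodicOrbit V Γ' → Γ' ⊆ U → Γ' = Γ

/-- The Liénard vector field `ẋ = y, ẏ = -g(x) - ε f(x) y`. -/
def lienard (f g : Polynomial ℝ) (ε : ℝ) : ℝ × ℝ → ℝ × ℝ :=
  fun p => (p.2, -(g.eval p.1) - ε * (f.eval p.1) * p.2)

/-- `HGe n m c` formalizes `H(n,m) ≥ c`: there are polynomials `f, g` with
`deg f ≤ n`, `deg g ≤ m` and `ε₀ > 0` such that for every `0 < ε ≤ ε₀` the
Liénard system has at least `c` pairwise distinct limit cycles. -/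
def HGe (n m : ℕ) (c : ℝ) : Prop :=
  ∃ f g : Polynomial ℝ, f.natDegree ≤ n ∧ g.natDegree ≤ m ∧
    ∃ ε₀ : ℝ, 0 < ε₀ ∧ ∀ ε : ℝ, 0 < ε → ε ≤ ε₀ →
      ∃ S : Finset (Set (ℝ × ℝ)),
        (∀ Γ ∈ S, IsLimitCycle (lienard f g ε) Γ) ∧ c ≤ (S.card : ℝ)

/-- The Liénard system in the form `ẋ = y - εF(x), ẏ = -g(x)`. -/
def lienardF (F g : Polynomial ℝ) (ε : ℝ) : ℝ × ℝ → ℝ × ℝ :=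
  fun p => (p.2 - ε * F.eval p.1, -(g.eval p.1))

/-- The transformed system `ẋ = y - εF(x² + x₀), ẏ = -2x·g(x² + x₀)`. -/
def lienardFsq (F g : Polynomial ℝ) (x₀ ε : ℝ) : ℝ × ℝ → ℝ × ℝ :=
  fun p => (p.2 - ε * F.eval (p.1 ^ 2 + x₀), -(2 * p.1 * g.eval (p.1 ^ 2 + x₀)))

/-- A periodic curve which is everywhere tangent to `V`, with positive speed factor `c`,
parametrizes a periodic orbit of `V`. -/
theorem isPeriodicOrbit_range_of_pos {V : ℝ × ℝ → ℝ × ℝ} {γ : ℝ → ℝ × ℝ} {c : ℝ → ℝ} {T : ℝ}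
    (hγ : ∀ t, HasDerivAt γ (c t • V (γ t)) t) (hT : 0 < T) (hper : Function.Periodic γ T)
    (hne : ∃ t₁ t₂, γ t₁ ≠ γ t₂) (hc : Continuous c) (hcT : Function.Periodic c T)
    (hpos : ∀ t, 0 < c t) : IsPeriodicOrbit V (Set.range γ) := by
  have hint (a b : ℝ) : IntervalIntegrable c MeasureTheory.volume a b := hc.intervalIntegrable a b
  set C : ℝ → ℝ := fun t => ∫ x in (0 : ℝ)..t, c x with hC
  have hderiv (t : ℝ) : HasDerivAt C (c t) t :=
    intervalIntegral.integral_hasDerivAt_right (hint 0 t)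
      (hc.stronglyMeasurableAtFilter _ _) hc.continuousAt
  have hCcont : Continuous C := continuous_iff_continuousAt.2 fun t => (hderiv t).continuousAt
  have hmono : StrictMono C := strictMono_of_hasDerivAt_pos hderiv hpos
  have hsurj : Function.Surjective C := hCcont.surjective
    (hcT.tendsto_atTop_intervalIntegral_of_pos' (hint 0 T) hpos hT)
    (hcT.tendsto_atBot_intervalIntegral_of_pos' (hint 0 T) hpos hT)
  have hadd (t : ℝ) : C (t + T) = C t + C T := by
    have h := hcT.intervalIntegral_add_eq t 0
    simp only [zero_add] at h
    simp only [hC]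
    rw [← intervalIntegral.integral_add_adjacent_intervals (hint 0 t) (hint t (t + T)), h]
  let e : ℝ ≃o ℝ := hmono.orderIsoOfSurjective C hsurj
  have he (t : ℝ) : C (e.symm t) = t := e.apply_symm_apply t
  have he' (t : ℝ) : e.symm (C t) = t := e.symm_apply_apply t
  have hs (t : ℝ) : HasDerivAt e.symm (c (e.symm t))⁻¹ t :=
    (hderiv (e.symm t)).of_local_left_inverse e.symm.continuous.continuousAt (hpos _).ne'
      (Eventually.of_forall he)
  refine ⟨γ ∘ e.symm, fun t => ?_, ⟨C T, ?_, fun t => ?_⟩, ?_, ?_⟩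
  · have h := (hγ (e.symm t)).scomp t (hs t)
    rwa [smul_smul, inv_mul_cancel₀ (hpos _).ne', one_smul] at h
  · have h := hmono hT
    simpa [hC] using h
  · have h : e.symm (t + C T) = e.symm t + T := by
      rw [← he' (e.symm t + T), hadd, he]
    simp only [Function.comp_apply, h, hper _]
  · obtain ⟨t₁, t₂, h⟩ := hne
    exact ⟨C t₁, C t₂, by simpa only [Function.comp_apply, he'] using h⟩
  · exact (e.symm.surjective.range_comp γ).symm

/-- The sign-constant version of `isPeriodicOrbit_range_of_pos`. -/
theorem isPeriodicOrbit_range {V : ℝ × ℝ → ℝ × ℝ} {γ : ℝ → ℝ × ℝ} {c : ℝ → ℝ} {T σ : ℝ}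
    (hγ : ∀ t, HasDerivAt γ (c t • V (γ t)) t) (hT : 0 < T) (hper : Function.Periodic γ T)
    (hne : ∃ t₁ t₂, γ t₁ ≠ γ t₂) (hc : Continuous c) (hcT : Function.Periodic c T)
    (hσ : σ = 1 ∨ σ = -1) (hpos : ∀ t, 0 < σ * c t) : IsPeriodicOrbit V (Set.range γ) := by
  rcases hσ with rfl | rfl
  · exact isPeriodicOrbit_range_of_pos hγ hT hper hne hc hcT (by simpa using hpos)
  · have h : IsPeriodicOrbit V (Set.range (γ ∘ Neg.neg)) := by
      refine isPeriodicOrbit_range_of_pos (c := fun t => -c (-t)) (T := T) (fun t => ?_) hT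
        (fun t => ?_) ?_ (by fun_prop) (fun t => ?_) fun t => by simpa using hpos (-t)
      · have h := (hγ (-t)).scomp t (hasDerivAt_neg t)
        rwa [smul_smul, neg_one_mul] at h
      · simpa [neg_add', -neg_add_rev] using hper.sub_eq (-t)
      · obtain ⟨t₁, t₂, h⟩ := hne
        exact ⟨-t₁, -t₂, by simpa using h⟩
      · simpa [neg_add', -neg_add_rev] using hcT.sub_eq (-t)
    rwa [neg_surjective.range_comp γ] at h

/-- The folding map `(x, y) ↦ (x² + x₀, y)`. -/
def fold (x₀ : ℝ) (p : ℝ × ℝ) : ℝ × ℝ := (p.1 ^ 2 + x₀, p.2)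

/-- The inverse branch of `fold x₀` on the half-plane where `x` has the sign `σ`. -/
noncomputable def unfoldBranch (σ x₀ : ℝ) (p : ℝ × ℝ) : ℝ × ℝ := (σ * √(p.1 - x₀), p.2)

theorem fold_unfoldBranch {σ x₀ : ℝ} (hσ : σ = 1 ∨ σ = -1) {p : ℝ × ℝ} (hp : x₀ < p.1) :
    fold x₀ (unfoldBranch σ x₀ p) = p := by
  have h2 : σ ^ 2 = 1 := by rcases hσ with rfl | rfl <;> norm_num
  simp [fold, unfoldBranch, mul_pow, h2, Real.sq_sqrt (sub_nonneg.2 hp.le)]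

theorem unfoldBranch_fold {σ x₀ : ℝ} (hσ : σ = 1 ∨ σ = -1) {p : ℝ × ℝ} (hp : 0 < σ * p.1) :
    unfoldBranch σ x₀ (fold x₀ p) = p := by
  rcases hσ with rfl | rfl
  · simp only [one_mul] at hp
    simp [fold, unfoldBranch, Real.sqrt_sq hp.le]
  · have hp' : p.1 < 0 := by linarith
    simp [fold, unfoldBranch, Real.sqrt_sq_eq_abs, abs_of_neg hp']

theorem sign_mul_unfoldBranch_pos {σ x₀ : ℝ} (hσ : σ = 1 ∨ σ = -1) {p : ℝ × ℝ} (hp : x₀ < p.1) :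
    0 < σ * (unfoldBranch σ x₀ p).1 := by
  have h := Real.sqrt_pos.2 (sub_pos.2 hp)
  rcases hσ with rfl | rfl <;> simpa [unfoldBranch] using h

theorem fold_image_unfoldBranch_image {σ x₀ : ℝ} (hσ : σ = 1 ∨ σ = -1) {Γ : Set (ℝ × ℝ)}
    (hΓ : ∀ p ∈ Γ, x₀ < p.1) : fold x₀ '' (unfoldBranch σ x₀ '' Γ) = Γ := by
  rw [Set.image_image, Set.image_congr fun p hp => fold_unfoldBranch hσ (hΓ p hp), Set.image_id']

theorem unfoldBranch_image_fold_image {σ x₀ : ℝ} (hσ : σ = 1 ∨ σ = -1) {Γ : Set (ℝ × ℝ)}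
    (hΓ : ∀ p ∈ Γ, 0 < σ * p.1) : unfoldBranch σ x₀ '' (fold x₀ '' Γ) = Γ := by
  rw [Set.image_image, Set.image_congr fun p hp => unfoldBranch_fold hσ (hΓ p hp), Set.image_id']

theorem IsPeriodicOrbit.unfoldBranch_image {F g : Polynomial ℝ} {σ x₀ ε : ℝ} {Γ : Set (ℝ × ℝ)}
    (hΓ : IsPeriodicOrbit (lienardF F g ε) Γ) (hσ : σ = 1 ∨ σ = -1)
    (hx : ∀ p ∈ Γ, x₀ < p.1) :
    IsPeriodicOrbit (lienardFsq F g x₀ ε) (unfoldBranch σ x₀ '' Γ) := by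
  obtain ⟨γ, hγ, ⟨T, hT, hper⟩, ⟨t₁, t₂, hne⟩, rfl⟩ := hΓ
  replace hx (t : ℝ) : x₀ < (γ t).1 := hx _ ⟨t, rfl⟩
  have hr (t : ℝ) : 0 < √((γ t).1 - x₀) := Real.sqrt_pos.2 (sub_pos.2 (hx t))
  have hcont : Continuous γ := continuous_iff_continuousAt.2 fun t => (hγ t).continuousAt
  have h2 : σ ^ 2 = 1 := by rcases hσ with rfl | rfl <;> norm_num
  rw [← Set.range_comp]
  refine isPeriodicOrbit_range (c := fun t => σ / (2 * √((γ t).1 - x₀))) (T := T) (σ := σ)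
    (fun t => ?_) hT (fun t => by simp only [Function.comp_apply, hper t])
    ⟨t₁, t₂, fun h => hne ?_⟩ ?_ (fun t => by simp only [hper t]) hσ fun t => ?_
  · have h₁ : HasDerivAt (fun t => (γ t).1) (lienardF F g ε (γ t)).1 t := (hγ t).fst
    have h₂ : HasDerivAt (fun t => (γ t).2) (lienardF F g ε (γ t)).2 t := (hγ t).snd
    have h := (((h₁.sub_const x₀).sqrt (sub_pos.2 (hx t)).ne').const_mul σ).prodMk h₂
    have hf : (σ * √((γ t).1 - x₀)) ^ 2 + x₀ = (γ t).1 :=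
      congrArg Prod.fst (fold_unfoldBranch hσ (hx t))
    have hr' := (hr t).ne'
    refine h.congr_deriv (Prod.ext ?_ ?_)
    · simp only [lienardF, lienardFsq, unfoldBranch, Function.comp_apply, Prod.smul_fst,
        smul_eq_mul, hf]
      ring
    · simp only [lienardF, lienardFsq, unfoldBranch, Function.comp_apply, Prod.smul_snd,
        smul_eq_mul, hf]
      field_simp
      linear_combination g.eval (γ t).1 * h2
  · have h' := congrArg (fold x₀) h
    simpa only [Function.comp_apply, fold_unfoldBranch hσ (hx _)] using h'
  · exact continuous_const.div (by fun_prop) fun t => by have := hr t; positivity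
  · have := hr t
    have e : σ * (σ / (2 * √((γ t).1 - x₀))) = σ ^ 2 / (2 * √((γ t).1 - x₀)) := by ring
    rw [e, h2]
    positivity

theorem IsPeriodicOrbit.fold_image {F g : Polynomial ℝ} {σ x₀ ε : ℝ} {Γ : Set (ℝ × ℝ)}
    (hΓ : IsPeriodicOrbit (lienardFsq F g x₀ ε) Γ) (hσ : σ = 1 ∨ σ = -1)
    (hx : ∀ p ∈ Γ, 0 < σ * p.1) :
    IsPeriodicOrbit (lienardF F g ε) (fold x₀ '' Γ) := by
  obtain ⟨γ, hγ, ⟨T, hT, hper⟩, ⟨t₁, t₂, hne⟩, rfl⟩ := hΓ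
  replace hx (t : ℝ) : 0 < σ * (γ t).1 := hx _ ⟨t, rfl⟩
  have hcont : Continuous γ := continuous_iff_continuousAt.2 fun t => (hγ t).continuousAt
  rw [← Set.range_comp]
  refine isPeriodicOrbit_range (c := fun t => 2 * (γ t).1) (T := T) (σ := σ)
    (fun t => ?_) hT (fun t => by simp only [Function.comp_apply, hper t])
    ⟨t₁, t₂, fun h => hne ?_⟩ (by fun_prop) (fun t => by simp only [hper t]) hσ
    fun t => by linarith [hx t]
  · have h₁ : HasDerivAt (fun t => (γ t).1) (lienardFsq F g x₀ ε (γ t)).1 t := (hγ t).fst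
    have h₂ : HasDerivAt (fun t => (γ t).2) (lienardFsq F g x₀ ε (γ t)).2 t := (hγ t).snd
    have h := ((h₁.pow 2).add_const x₀).prodMk h₂
    refine h.congr_deriv (Prod.ext ?_ ?_) <;> simp [lienardF, lienardFsq, fold]
  · have h' := congrArg (unfoldBranch σ x₀) h
    simpa only [Function.comp_apply, unfoldBranch_fold hσ (hx _)] using h'

theorem IsLimitCycle.unfoldBranch_image {F g : Polynomial ℝ} {σ x₀ ε : ℝ} {Γ : Set (ℝ × ℝ)}
    (hΓ : IsLimitCycle (lienardF F g ε) Γ) (hσ : σ = 1 ∨ σ = -1) (hx : ∀ p ∈ Γ, x₀ < p.1) :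
    IsLimitCycle (lienardFsq F g x₀ ε) (unfoldBranch σ x₀ '' Γ) := by
  obtain ⟨hper, U, hU, hΓU, huniq⟩ := hΓ
  refine ⟨hper.unfoldBranch_image hσ hx, {p | 0 < σ * p.1} ∩ fold x₀ ⁻¹' U,
    (isOpen_lt (by fun_prop) (by fun_prop)).inter (hU.preimage (by unfold fold; fun_prop)),
    ?_, fun Γ' hΓ' hsub => ?_⟩
  · rintro _ ⟨p, hp, rfl⟩
    exact ⟨sign_mul_unfoldBranch_pos hσ (hx p hp), by
      simpa only [Set.mem_preimage, fold_unfoldBranch hσ (hx p hp)] using hΓU hp⟩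
  · have hpos : ∀ p ∈ Γ', 0 < σ * p.1 := fun p hp => (hsub hp).1
    rw [← huniq _ (hΓ'.fold_image hσ hpos) (Set.image_subset_iff.2 fun p hp => (hsub hp).2),
      unfoldBranch_image_fold_image hσ hpos]

theorem IsPeriodicOrbit.nonempty {V : ℝ × ℝ → ℝ × ℝ} {Γ : Set (ℝ × ℝ)}
    (hΓ : IsPeriodicOrbit V Γ) : Γ.Nonempty := by
  obtain ⟨γ, -, -, -, rfl⟩ := hΓ
  exact Set.range_nonempty γ

theorem stmt17 (F g : Polynomial ℝ) (k : ℕ) (ε₀ : ℝ) (hε₀ : 0 < ε₀)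
    (D : Set (ℝ × ℝ)) (hD : IsCompact D)
    (h : ∀ ε : ℝ, 0 < ε → ε ≤ ε₀ →
      ∃ S : Finset (Set (ℝ × ℝ)),
        (∀ Γ ∈ S, IsLimitCycle (lienardF F g ε) Γ ∧ Γ ⊆ D) ∧ k ≤ S.card) :
    ∃ xs : ℝ, 0 < xs ∧ ∀ x₀ : ℝ, x₀ < -xs → ∀ ε : ℝ, 0 < ε → ε ≤ ε₀ →
      ∃ S : Finset (Set (ℝ × ℝ)),
        (∀ Γ ∈ S, IsLimitCycle (lienardFsq F g x₀ ε) Γ) ∧ 2 * k ≤ S.card := by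
  classical
  obtain ⟨R, hR⟩ := hD.isBounded.exists_norm_le
  refine ⟨|R| + 1, by positivity, fun x₀ hx₀ ε hε hε' => ?_⟩
  have hDx : ∀ p ∈ D, x₀ < p.1 := fun p hp => by
    have h₁ := (norm_fst_le p).trans (hR p hp)
    rw [Real.norm_eq_abs] at h₁
    linarith [neg_abs_le p.1, le_abs_self R]
  obtain ⟨S, hS, hcard⟩ := h ε hε hε'
  have hx : ∀ Γ ∈ S, ∀ p ∈ Γ, x₀ < p.1 := fun Γ hΓ p hp => hDx p ((hS Γ hΓ).2 hp)
  have hinj {σ : ℝ} (hσ : σ = 1 ∨ σ = -1) : Set.InjOn (Set.image (unfoldBranch σ x₀)) S :=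
    Set.LeftInvOn.injOn (f₁' := Set.image (fold x₀)) fun Γ hΓ =>
      fold_image_unfoldBranch_image hσ (hx Γ hΓ)
  have hdisj : Disjoint (S.image (Set.image (unfoldBranch 1 x₀)))
      (S.image (Set.image (unfoldBranch (-1) x₀))) := by
    simp only [Finset.disjoint_left, Finset.mem_image, not_exists, not_and]
    rintro _ ⟨Γ, hΓ, rfl⟩ Γ' hΓ' heq
    obtain ⟨p, hp⟩ := (hS Γ hΓ).1.1.nonempty
    obtain ⟨q, hq, hqp⟩ := heq ▸ Set.mem_image_of_mem (unfoldBranch 1 x₀) hp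
    have h₁ := sign_mul_unfoldBranch_pos (.inl rfl) (hx Γ hΓ p hp)
    have h₂ := sign_mul_unfoldBranch_pos (.inr rfl) (hx Γ' hΓ' q hq)
    rw [hqp] at h₂
    linarith
  refine ⟨S.image (Set.image (unfoldBranch 1 x₀)) ∪ S.image (Set.image (unfoldBranch (-1) x₀)),
    ?_, ?_⟩
  · simp only [Finset.mem_union, Finset.mem_image]
    rintro _ (⟨Γ, hΓ, rfl⟩ | ⟨Γ, hΓ, rfl⟩)
    · exact (hS Γ hΓ).1.unfoldBranch_image (.inl rfl) (hx Γ hΓ)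
    · exact (hS Γ hΓ).1.unfoldBranch_image (.inr rfl) (hx Γ hΓ)
  · rw [Finset.card_union_of_disjoint hdisj, Finset.card_image_of_injOn (hinj (.inl rfl)),
      Finset.card_image_of_injOn (hinj (.inr rfl))]
    omega
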